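/- The even hyperbolic lattice U ⊕ E₇ ⊕ E₇ ⊕ A₁ ⊕ A₁ (the 2-elementary lattice with invariants (r,a,δ) = (18,4,1)) is not reflective: the subgroup W_r of O(S) generated by reflections in all roots has infinite index in O(S). -/

import Mathlib

open Matrix

/-- The bilinear form on `ℤⁿ` associated to a Gram matrix `G`. -/
def bform {n : ℕ} (G : Matrix (Fin n) (Fin n) ℤ) (x y : Fin n → ℤ) : ℤ :=
  x ⬝ᵥ G.mulVec y

/-- The orthogonal group `O(S)` of the lattice with Gram matrix `G`:
all `ℤ`-module automorphisms preserving the bilinear form. -/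
def OrthGroup (n : ℕ) (G : Matrix (Fin n) (Fin n) ℤ) :
    Subgroup ((Fin n → ℤ) ≃ₗ[ℤ] (Fin n → ℤ)) where
  carrier := {f | ∀ x y, bform G (f x) (f y) = bform G x y}
  one_mem' := fun _ _ => rfl
  mul_mem' := by
    intro f g hf hg x y
    exact (hf (g x) (g y)).trans (hg x y)
  inv_mem' := by
    intro f hf x y
    have h := (hf (f⁻¹ x) (f⁻¹ y)).symm
    rwa [show f (f⁻¹ x) = x from f.apply_symm_apply x,
      show f (f⁻¹ y) = y from f.apply_symm_apply y] at h

/-- A root: a vector of square `-2`, or of square `-4` whose pairing with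
the whole lattice is even. -/
def IsRoot {n : ℕ} (G : Matrix (Fin n) (Fin n) ℤ) (α : Fin n → ℤ) : Prop :=
  bform G α α = -2 ∨ (bform G α α = -4 ∧ ∀ x : Fin n → ℤ, (2 : ℤ) ∣ bform G α x)

/-- `f` is the reflection in a root `α`. -/
def IsReflection {n : ℕ} (G : Matrix (Fin n) (Fin n) ℤ)
    (f : (Fin n → ℤ) ≃ₗ[ℤ] (Fin n → ℤ)) : Prop :=
  ∃ α : Fin n → ℤ, IsRoot G α ∧
    ∀ x : Fin n → ℤ, f x = x - ((2 * bform G x α) / bform G α α) • α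

/-- The subgroup `W_r` of `O(S)` generated by the reflections in all roots. -/
def Wr (n : ℕ) (G : Matrix (Fin n) (Fin n) ℤ) : Subgroup ↥(OrthGroup n G) :=
  Subgroup.closure {f | IsReflection G f.val}

open Matrix

/-- Orthogonal direct sum of two Gram matrices. -/
def dsum {m k : ℕ} (A : Matrix (Fin m) (Fin m) ℤ) (B : Matrix (Fin k) (Fin k) ℤ) :
    Matrix (Fin (m + k)) (Fin (m + k)) ℤ :=
  Matrix.reindex finSumFinEquiv finSumFinEquiv (Matrix.fromBlocks A 0 0 B)

/-- Gram matrix of the hyperbolic plane `U`. -/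
def gramU : Matrix (Fin 2) (Fin 2) ℤ := !![0, 1; 1, 0]

/-- Gram matrix of `A₁ = ⟨-2⟩`. -/
def gramA1 : Matrix (Fin 1) (Fin 1) ℤ := !![-2]

/-- Gram matrix (= negative Cartan matrix) of a simply laced root lattice with
given Dynkin diagram edges. -/
def adjGram (n : ℕ) (E : List (ℕ × ℕ)) : Matrix (Fin n) (Fin n) ℤ :=
  Matrix.of fun i j =>
    if i = j then -2 else if (i.1, j.1) ∈ E ∨ (j.1, i.1) ∈ E then 1 else 0

/-- Gram matrix of the negative definite root lattice `Dₙ`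
(in the root basis `e₁+e₂, e₂-e₁, e₃-e₂, …, eₙ-eₙ₋₁` of `{x ∈ ℤⁿ : Σxᵢ even}`
with the negative of the standard Euclidean form). -/
def gramD (n : ℕ) : Matrix (Fin n) (Fin n) ℤ :=
  adjGram n ((0, 2) :: (List.range (n - 2)).map fun k => (k + 1, k + 2))

/-- Gram matrix (negative Cartan matrix) of `E₈`. -/
def gramE8 : Matrix (Fin 8) (Fin 8) ℤ :=
  adjGram 8 [(0, 2), (1, 3), (2, 3), (3, 4), (4, 5), (5, 6), (6, 7)]

/-- Gram matrix (negative Cartan matrix) of `E₇`. -/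
def gramE7 : Matrix (Fin 7) (Fin 7) ℤ :=
  adjGram 7 [(0, 2), (1, 3), (2, 3), (3, 4), (4, 5), (5, 6)]

/-- The Gram matrix of the even 2-elementary hyperbolic lattice `U ⊕ E₇ ⊕ E₇ ⊕ A₁ ⊕ A₁`,
with invariants `(r,a,δ) = (18,4,1)`. -/
def gramS :=
  dsum gramU (dsum gramE7 (dsum gramE7 (dsum gramA1 gramA1)))

section Bform

variable {n : ℕ} {G : Matrix (Fin n) (Fin n) ℤ}

lemma bform_add_left (x y z : Fin n → ℤ) : bform G (x + y) z = bform G x z + bform G y z := by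
  simp [bform, add_dotProduct]

lemma bform_add_right (x y z : Fin n → ℤ) : bform G x (y + z) = bform G x y + bform G x z := by
  simp [bform, mulVec_add, dotProduct_add]

lemma bform_smul_left (c : ℤ) (x y : Fin n → ℤ) : bform G (c • x) y = c * bform G x y := by
  rw [bform, bform, smul_dotProduct, smul_eq_mul]

lemma bform_smul_right (c : ℤ) (x y : Fin n → ℤ) : bform G x (c • y) = c * bform G x y := by
  rw [bform, bform, mulVec_smul, dotProduct_smul, smul_eq_mul]

lemma bform_neg_left (x y : Fin n → ℤ) : bform G (-x) y = -bform G x y := by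
  simp [bform]

lemma bform_neg_right (x y : Fin n → ℤ) : bform G x (-y) = -bform G x y := by
  simp [bform, mulVec_neg]

lemma bform_sub_left (x y z : Fin n → ℤ) : bform G (x - y) z = bform G x z - bform G y z := by
  simp [bform, sub_dotProduct]

lemma bform_sub_right (x y z : Fin n → ℤ) : bform G x (y - z) = bform G x y - bform G x z := by
  simp [bform, mulVec_sub, dotProduct_sub]

lemma bform_comm (hG : G.IsSymm) (x y : Fin n → ℤ) : bform G x y = bform G y x := by
  rw [bform, bform, dotProduct_mulVec, ← mulVec_transpose, hG.eq, dotProduct_comm]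

/-- The form is negative definite on the orthogonal complement of every vector of positive
square. -/
def IsLorentzian (G : Matrix (Fin n) (Fin n) ℤ) : Prop :=
  ∀ x y : Fin n → ℤ, 0 < bform G x x → bform G x y = 0 → y ≠ 0 → bform G y y < 0

lemma IsLorentzian.nonpos (hL : IsLorentzian G) {x y : Fin n → ℤ} (hx : 0 < bform G x x)
    (hxy : bform G x y = 0) : bform G y y ≤ 0 := by
  by_cases hy : y = 0
  · simp [hy, bform]
  · exact (hL x y hx hxy hy).le

/-- Nonnegativity of the Gram determinant of `p, α, β`, where `p` has positive square. -/
lemma IsLorentzian.gram_bound (hG : G.IsSymm) (hL : IsLorentzian G) {p α β : Fin n → ℤ}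
    (hp : 0 < bform G p p) (hα : bform G α α < 0) :
    bform G p p * bform G α β ^ 2 - 2 * bform G p α * bform G p β * bform G α β ≤
      bform G p p * (bform G α α * bform G β β) - bform G p α ^ 2 * bform G β β
        - bform G p β ^ 2 * bform G α α := by
  set P := bform G p p with hP
  set h := bform G p α with hh
  set k := bform G p β with hk
  set N := bform G α α with hN
  set N' := bform G β β with hN'
  set m := bform G α β with hm
  have hpos : 0 < h ^ 2 - P * N := by nlinarith [sq_nonneg h]
  have key := hL.nonpos (y := (h * k - P * m) • (P • α - h • p)
      - (h ^ 2 - P * N) • (P • β - k • p)) hp (by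
    simp only [bform_sub_right, bform_smul_right, ← hP, ← hh, ← hk]; ring)
  simp only [bform_sub_right, bform_smul_right, bform_sub_left, bform_smul_left,
    bform_comm hG α p, bform_comm hG β p, bform_comm hG β α, ← hP, ← hh, ← hk, ← hN, ← hN',
    ← hm] at key
  have e : P * (h ^ 2 - P * N) * P *
      ((P * (N * N') - h ^ 2 * N' - k ^ 2 * N) - (P * m ^ 2 - 2 * h * k * m)) ≥ 0 := by
    nlinarith [key]
  have := nonneg_of_mul_nonneg_right e (by positivity)
  linarith

end Bform

section Roots

variable {n : ℕ} {G : Matrix (Fin n) (Fin n) ℤ}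

/-- The pairing of `x` with the coroot of `α`. -/
def cpair (G : Matrix (Fin n) (Fin n) ℤ) (x α : Fin n → ℤ) : ℤ :=
  (2 * bform G x α) / bform G α α

lemma IsRoot.norm_eq {α : Fin n → ℤ} (hα : IsRoot G α) :
    bform G α α = -2 ∨ bform G α α = -4 :=
  hα.imp_right And.left

lemma IsRoot.cpair_mul (hG : G.IsSymm) {α : Fin n → ℤ} (hα : IsRoot G α) (x : Fin n → ℤ) :
    cpair G x α * bform G α α = 2 * bform G x α := by
  apply Int.ediv_mul_cancel
  rcases hα with h | ⟨h, h'⟩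
  · rw [h]; exact ⟨-bform G x α, by ring⟩
  · obtain ⟨c, hc⟩ := h' x
    rw [h, bform_comm hG, hc]; exact ⟨-c, by ring⟩

lemma IsRoot.neg {α : Fin n → ℤ} (hα : IsRoot G α) : IsRoot G (-α) := by
  simpa only [IsRoot, bform_neg_left, bform_neg_right, neg_neg, dvd_neg] using hα

lemma IsRoot.sub_cpair (hG : G.IsSymm) {α β : Fin n → ℤ} (hα : IsRoot G α) (hβ : IsRoot G β) :
    IsRoot G (α - cpair G α β • β) := by
  have hc := hβ.cpair_mul hG α
  have hn : bform G (α - cpair G α β • β) (α - cpair G α β • β) = bform G α α := by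
    simp only [bform_sub_left, bform_sub_right, bform_smul_left, bform_smul_right,
      bform_comm hG β α]
    linear_combination (cpair G α β) * hc
  rw [IsRoot, hn]
  refine hα.imp_right fun ⟨h, h'⟩ => ⟨h, fun x => ?_⟩
  rw [bform_sub_left, bform_smul_left]
  refine dvd_sub (h' x) ?_
  rcases hβ with h2 | ⟨-, h4⟩
  · refine Dvd.dvd.mul_right ?_ _
    obtain ⟨d, hd⟩ := h' β
    exact ⟨-d, by rw [h2, hd] at hc; linarith⟩
  · exact (h4 x).mul_left _

lemma IsRoot.map {α : Fin n → ℤ} (hα : IsRoot G α) {f : (Fin n → ℤ) ≃ₗ[ℤ] (Fin n → ℤ)}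
    (hf : f ∈ OrthGroup n G) : IsRoot G (f α) := by
  rw [IsRoot, hf α α]
  refine hα.imp_right fun ⟨h, h'⟩ => ⟨h, fun x => ?_⟩
  have := hf α (f.symm x)
  rw [f.apply_symm_apply] at this
  rw [this]
  exact h' _

/-- `f` is the reflection in `α`. -/
def IsReflectionIn (G : Matrix (Fin n) (Fin n) ℤ) (f : (Fin n → ℤ) ≃ₗ[ℤ] (Fin n → ℤ))
    (α : Fin n → ℤ) : Prop :=
  ∀ x, f x = x - cpair G x α • α

variable {f g : (Fin n → ℤ) ≃ₗ[ℤ] (Fin n → ℤ)} {α : Fin n → ℤ}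

lemma IsReflectionIn.unique (hf : IsReflectionIn G f α) (hg : IsReflectionIn G g α) : f = g :=
  LinearEquiv.ext fun x => (hf x).trans (hg x).symm

lemma IsRoot.cpair_self {α : Fin n → ℤ} (hα : IsRoot G α) : cpair G α α = 2 := by
  rcases hα.norm_eq with h | h <;> simp [cpair, h]

lemma IsReflectionIn.apply_self (hf : IsReflectionIn G f α) (hα : IsRoot G α) : f α = -α := by
  rw [hf α, hα.cpair_self]
  module

lemma IsRoot.cpair_neg (hG : G.IsSymm) {α : Fin n → ℤ} (hα : IsRoot G α) (x : Fin n → ℤ) :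
    cpair G x (-α) = -cpair G x α := by
  have h1 := hα.neg.cpair_mul hG x
  have h2 := hα.cpair_mul hG x
  simp only [bform_neg_left, bform_neg_right, neg_neg] at h1
  have h0 : bform G α α ≠ 0 := by rcases hα.norm_eq with h | h <;> simp [h]
  apply mul_right_cancel₀ h0
  linear_combination h1 + h2

lemma IsReflectionIn.neg (hG : G.IsSymm) (hf : IsReflectionIn G f α) (hα : IsRoot G α) :
    IsReflectionIn G f (-α) := fun x => by
  rw [hf x, hα.cpair_neg hG]
  module

lemma IsReflectionIn.mem_orthGroup (hG : G.IsSymm) (hf : IsReflectionIn G f α)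
    (hα : IsRoot G α) : f ∈ OrthGroup n G := fun x y => by
  have hx := hα.cpair_mul hG x
  have hy := hα.cpair_mul hG y
  rw [hf x, hf y]
  simp only [bform_sub_left, bform_sub_right, bform_smul_left, bform_smul_right,
      bform_comm hG α y]
  apply mul_left_cancel₀ (two_ne_zero (α := ℤ))
  linear_combination (cpair G y α) * hx + (cpair G x α) * hy

lemma IsReflectionIn.mul_self (hf : IsReflectionIn G f α)
    (hα : IsRoot G α) : f * f = 1 := LinearEquiv.ext fun x => by
  have h : f (f x) = x := by
    rw [hf x, map_sub, map_smul, hf.apply_self hα, hf x]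
    module
  exact h

lemma IsReflectionIn.inv_eq (hf : IsReflectionIn G f α)
    (hα : IsRoot G α) : f⁻¹ = f :=
  inv_eq_of_mul_eq_one_left (hf.mul_self hα)

lemma IsReflectionIn.conj (hf : IsReflectionIn G f α) (hg : g ∈ OrthGroup n G) :
    IsReflectionIn G (g * f * g⁻¹) (g α) := fun x => by
  have e : g (g⁻¹ x) = x := g.apply_symm_apply x
  have h : cpair G x (g α) = cpair G (g⁻¹ x) α := by
    rw [cpair, cpair, hg α α, ← hg (g⁻¹ x) α, e]
  change g (f (g⁻¹ x)) = _
  rw [hf, map_sub, map_smul, e, h]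

lemma IsRoot.exists_reflection (hG : G.IsSymm) {α : Fin n → ℤ} (hα : IsRoot G α) :
    ∃ f : (Fin n → ℤ) ≃ₗ[ℤ] (Fin n → ℤ), IsReflectionIn G f α := by
  have hadd (x y : Fin n → ℤ) : cpair G (x + y) α = cpair G x α + cpair G y α := by
    have h0 : bform G α α ≠ 0 := by rcases hα.norm_eq with h | h <;> simp [h]
    apply mul_right_cancel₀ h0
    rw [add_mul, hα.cpair_mul hG, hα.cpair_mul hG, hα.cpair_mul hG, bform_add_left, mul_add]
  have hsmul (c : ℤ) (x : Fin n → ℤ) : cpair G (c • x) α = c * cpair G x α := by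
    have h0 : bform G α α ≠ 0 := by rcases hα.norm_eq with h | h <;> simp [h]
    apply mul_right_cancel₀ h0
    rw [mul_assoc, hα.cpair_mul hG, hα.cpair_mul hG, bform_smul_left]
    ring
  let s : (Fin n → ℤ) →ₗ[ℤ] (Fin n → ℤ) :=
    { toFun := fun x => x - cpair G x α • α
      map_add' := fun x y => by rw [hadd]; module
      map_smul' := fun c x => by rw [hsmul, RingHom.id_apply]; module }
  refine ⟨LinearEquiv.ofInvolutive s fun x => ?_, fun x => rfl⟩
  have e (x) : s x = x - cpair G x α • α := rfl
  rw [e (s x), e x, sub_eq_add_neg x, ← neg_smul, hadd, hsmul, hα.cpair_self]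
  module

end Roots

section Chamber

variable {n : ℕ} {G : Matrix (Fin n) (Fin n) ℤ} {p : Fin n → ℤ}

/-- A positive root (with respect to `p`) whose reflection permutes the other positive roots. -/
structure IsSimpleRoot (G : Matrix (Fin n) (Fin n) ℤ) (p α : Fin n → ℤ) : Prop where
  isRoot : IsRoot G α
  pos : 0 < bform G p α
  pos_of_ne : ∀ γ, IsRoot G γ → 0 < bform G p γ → γ ≠ α → 0 < bform G p (γ - cpair G γ α • α)

/-- The point `p` lies on no mirror. -/
def IsGeneric (G : Matrix (Fin n) (Fin n) ℤ) (p : Fin n → ℤ) : Prop :=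
  ∀ α, IsRoot G α → bform G p α ≠ 0

/-- The reflections in simple roots. -/
def simpleReflections (G : Matrix (Fin n) (Fin n) ℤ) (p : Fin n → ℤ) :
    Set ((Fin n → ℤ) ≃ₗ[ℤ] (Fin n → ℤ)) :=
  {f | ∃ α, IsSimpleRoot G p α ∧ IsReflectionIn G f α}

lemma simpleReflections_subset (hG : G.IsSymm) :
    simpleReflections G p ⊆ OrthGroup n G := fun _ ⟨_, h, hf⟩ => hf.mem_orthGroup hG h.isRoot

lemma exists_eq_mul_of_map_neg (hG : G.IsSymm) (hp : IsGeneric G p) {α : Fin n → ℤ}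
    (hα : IsSimpleRoot G p α) {s : (Fin n → ℤ) ≃ₗ[ℤ] (Fin n → ℤ)} (hs : IsReflectionIn G s α) :
    ∀ L : List ((Fin n → ℤ) ≃ₗ[ℤ] (Fin n → ℤ)), (∀ f ∈ L, f ∈ simpleReflections G p) →
      bform G p (L.prod α) < 0 →
      ∃ L' : List ((Fin n → ℤ) ≃ₗ[ℤ] (Fin n → ℤ)), (∀ f ∈ L', f ∈ simpleReflections G p) ∧
        L'.length + 1 = L.length ∧ L.prod = L'.prod * s := by
  intro L
  induction L with
  | nil =>
    intro _ h
    exact absurd hα.pos (not_lt.2 (le_of_lt h))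
  | cons t L ih =>
    intro hL h
    rw [List.forall_mem_cons] at hL
    have hv : L.prod ∈ OrthGroup n G :=
      Subgroup.list_prod_mem _ fun f hf => simpleReflections_subset hG (hL.2 f hf)
    have hr : IsRoot G (L.prod α) := hα.isRoot.map hv
    rcases lt_or_gt_of_ne (hp _ hr) with h' | h'
    · obtain ⟨L', h1, h2, h3⟩ := ih hL.2 h'
      exact ⟨t :: L', List.forall_mem_cons.2 ⟨hL.1, h1⟩, by simp [h2],
        by rw [List.prod_cons, List.prod_cons, h3, mul_assoc]⟩
    · obtain ⟨β, hβ, ht⟩ := hL.1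
      have e : L.prod α = β := by
        by_contra hne
        have := hβ.pos_of_ne _ hr h' hne
        rw [← ht] at this
        rw [List.prod_cons] at h
        exact lt_asymm h this
      refine ⟨L, hL.2, rfl, ?_⟩
      have := hs.conj hv
      rw [e] at this
      rw [List.prod_cons, ht.unique this]
      group

/-- The group generated by the simple reflections acts freely on chambers. -/
lemma list_prod_eq_one (hG : G.IsSymm) (hp : IsGeneric G p) (k : ℕ) :
    ∀ L : List ((Fin n → ℤ) ≃ₗ[ℤ] (Fin n → ℤ)), L.length = k →
      (∀ f ∈ L, f ∈ simpleReflections G p) →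
      (∀ α, IsRoot G α → 0 < bform G p α → 0 < bform G p (L.prod α)) → L.prod = 1 := by
  induction k using Nat.strong_induction_on with
  | _ k ih =>
    intro L hk hL hpos
    rcases List.eq_nil_or_concat L with rfl | ⟨L, s, rfl⟩
    · rfl
    · rw [List.concat_eq_append] at *
      have hL1 : ∀ f ∈ L, f ∈ simpleReflections G p := fun f hf => hL f (by simp [hf])
      obtain ⟨α, hα, hs⟩ := hL s (by simp)
      have h1 := hpos α hα.isRoot hα.pos
      have e : (L ++ [s]).prod = L.prod * s := by simp
      have h2 : (L ++ [s]).prod α = -(L.prod α) := by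
        rw [e]
        change L.prod (s α) = _
        rw [hs.apply_self hα.isRoot, map_neg]
      rw [h2, bform_neg_right] at h1
      obtain ⟨L', h3, h4, h5⟩ := exists_eq_mul_of_map_neg hG hp hα hs L hL1 (by linarith)
      have e' : (L ++ [s]).prod = L'.prod := by
        rw [e, h5, mul_assoc, hs.mul_self hα.isRoot, mul_one]
      rw [e'] at hpos ⊢
      rw [List.length_append, List.length_singleton] at hk
      exact ih _ (by omega) L' rfl h3 hpos

end Chamber

section Generation

variable {n : ℕ} {G : Matrix (Fin n) (Fin n) ℤ} {p : Fin n → ℤ}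

/-- Among the positive roots `β` with `(β, α) < 0`, one whose mirror is met first when moving
from `p` towards the mirror of `α`; ties are broken by the height `(p, β)`. -/
lemma exists_first_mirror (hG : G.IsSymm) (hL : IsLorentzian G) (hpp : 0 < bform G p p)
    {α : Fin n → ℤ} (hα : IsRoot G α) (hpα : 0 < bform G p α) :
    ∃ β, IsRoot G β ∧ 0 < bform G p β ∧ bform G α β < 0 ∧
      bform G p β * bform G α α ≥ bform G p α * bform G α β ∧
      ∀ γ, IsRoot G γ → 0 < bform G p γ → bform G α γ < 0 →
        bform G p γ * bform G α β < bform G p β * bform G α γ ∨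
        (bform G p γ * bform G α β = bform G p β * bform G α γ ∧
          bform G p β ≤ bform G p γ) := by
  set P := bform G p p with hP
  set h := bform G p α with hh
  set N := bform G α α with hN
  have hN' : N = -2 ∨ N = -4 := hα.norm_eq
  let T : Set (Fin n → ℤ) := {β | IsRoot G β ∧ 0 < bform G p β ∧ bform G α β < 0 ∧
    bform G p β * N ≥ h * bform G α β}
  let F : (Fin n → ℤ) → ℤ × ℤ := fun β => (bform G p β, bform G α β)
  have hfin : (F '' T).Finite := by
    apply (Set.finite_Icc ((0 : ℤ), -(16 * P + 4 * h ^ 2)) (h * (16 * P + 4 * h ^ 2), 0)).subset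
    rintro _ ⟨β, ⟨hβ, h1, h2, h3⟩, rfl⟩
    have key := hL.gram_bound hG (p := p) (α := α) (β := β) hpp (by omega)
    rw [← hP, ← hh, ← hN] at key
    set k := bform G p β
    set m := bform G α β
    have hM : -m ≤ 16 * P + 4 * h ^ 2 := by
      have a1 : -m ≤ P * m ^ 2 := by nlinarith
      have a2 : k * (-(k * N) + 2 * (h * m)) ≤ 0 := by
        apply mul_nonpos_of_nonneg_of_nonpos h1.le
        nlinarith [mul_pos hpα (neg_pos.2 h2)]
      have a3 : P * (N * bform G β β) ≤ 16 * P := by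
        rcases hN' with e | e <;> rcases hβ.norm_eq with e' | e' <;> rw [e, e'] <;> linarith
      have a4 : -(h ^ 2 * bform G β β) ≤ 4 * h ^ 2 := by
        rcases hβ.norm_eq with e' | e' <;> rw [e'] <;> nlinarith [sq_nonneg h]
      nlinarith
    have hk : k ≤ h * (16 * P + 4 * h ^ 2) := by
      have : k ≤ h * (-m) := by
        rcases hN' with e | e <;> rw [e] at h3 <;> nlinarith
      nlinarith
    exact ⟨⟨h1.le, by change _ ≤ m; linarith⟩, ⟨hk, h2.le⟩⟩
  have hne : (F '' T).Nonempty := ⟨F α, α, ⟨hα, hpα, by rw [← hN]; omega, le_refl _⟩, rfl⟩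
  obtain ⟨_, ⟨β, hβ, rfl⟩, hmin⟩ := Set.exists_min_image (F '' T)
    (fun q => toLex ((q.1 : ℚ) / (-q.2 : ℚ), q.1)) hfin hne
  obtain ⟨hβ1, hβ2, hβ3, hβ4⟩ := hβ
  refine ⟨β, hβ1, hβ2, hβ3, hβ4, fun γ hγ h1 h2 => ?_⟩
  by_cases h3 : bform G p γ * N ≥ h * bform G α γ
  · have := hmin _ ⟨γ, ⟨hγ, h1, h2, h3⟩, rfl⟩
    have q1 : (0 : ℚ) < -(bform G α β : ℚ) := by exact_mod_cast neg_pos.2 hβ3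
    have q2 : (0 : ℚ) < -(bform G α γ : ℚ) := by exact_mod_cast neg_pos.2 h2
    rw [Prod.Lex.toLex_le_toLex] at this
    simp only [F] at this
    rw [div_lt_div_iff₀ q1 q2, div_eq_div_iff q1.ne' q2.ne'] at this
    rcases this with h | ⟨h, h'⟩
    · left
      have : bform G p β * -(bform G α γ) < bform G p γ * -(bform G α β) := by exact_mod_cast h
      linarith
    · right
      have : bform G p β * -(bform G α γ) = bform G p γ * -(bform G α β) := by exact_mod_cast h
      exact ⟨by linarith, h'⟩
  · left
    push Not at h3
    set k := bform G p β
    set m := bform G α β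
    set k' := bform G p γ
    set m' := bform G α γ
    have hN0 : 0 < -N := by omega
    have : 0 < (-N) * (k * m' - k' * m) := by nlinarith
    have := (mul_pos_iff_of_pos_left hN0).1 this
    linarith

lemma exists_isSimpleRoot (hG : G.IsSymm) (hL : IsLorentzian G) (hpp : 0 < bform G p p)
    (hp : IsGeneric G p) {α : Fin n → ℤ} (hα : IsRoot G α) (hpα : 0 < bform G p α) :
    ∃ β, IsSimpleRoot G p β ∧ bform G α β < 0 := by
  obtain ⟨β, hβ, hk, hm, hle, hmin⟩ := exists_first_mirror hG hL hpp hα hpα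
  refine ⟨β, ⟨hβ, hk, fun γ hγ hpγ hne => ?_⟩, hm⟩
  by_contra hcon
  have hr := hγ.sub_cpair hG hβ
  have hc := hβ.cpair_mul hG γ
  set c := cpair G γ β with hcdef
  have hcon' : bform G p (γ - c • β) < 0 := lt_of_le_of_ne (not_lt.1 hcon) (hp _ hr)
  -- the root `cβ - γ` is positive
  set δ := c • β - γ with hδ
  have hδr : IsRoot G δ := by
    have := hr.neg
    rwa [neg_sub] at this
  have hpδ : bform G p δ = c * bform G p β - bform G p γ := by
    rw [hδ, bform_sub_right, bform_smul_right]
  have hpδ' : 0 < bform G p δ := by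
    rw [bform_sub_right, bform_smul_right] at hcon'
    linarith
  have hαδ : bform G α δ = c * bform G α β - bform G α γ := by
    rw [hδ, bform_sub_right, bform_smul_right]
  set k := bform G p β with hkdef
  set m := bform G α β with hmdef
  -- the value at the point where the mirror of `β` is met
  have nonneg : ∀ μ, IsRoot G μ → 0 < bform G p μ → 0 ≤ k * bform G α μ - bform G p μ * m := by
    intro μ hμ hpμ
    by_cases hαμ : bform G α μ < 0
    · rcases hmin μ hμ hpμ hαμ with h | ⟨h, -⟩ <;> linarith
    · push Not at hαμ
      nlinarith [mul_nonneg hk.le hαμ, mul_pos hpμ (neg_pos.2 hm)]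
  have tie : ∀ μ, IsRoot G μ → 0 < bform G p μ → k * bform G α μ = bform G p μ * m →
      k ≤ bform G p μ := by
    intro μ hμ hpμ e
    have hαμ : bform G α μ < 0 := by
      by_contra h
      push Not at h
      nlinarith [mul_nonneg hk.le h, mul_pos hpμ (neg_pos.2 hm)]
    rcases hmin μ hμ hpμ hαμ with h | ⟨-, h⟩
    · linarith
    · exact h
  have h1 := nonneg γ hγ hpγ
  have h2 := nonneg δ hδr hpδ'
  have h2' : k * bform G α δ - bform G p δ * m = -(k * bform G α γ - bform G p γ * m) := by
    rw [hαδ, hpδ]; ring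
  have eγ : k * bform G α γ = bform G p γ * m := by linarith
  have eδ : k * bform G α δ = bform G p δ * m := by linarith
  have tγ := tie γ hγ hpγ eγ
  have tδ := tie δ hδr hpδ' eδ
  have hN := hα.norm_eq
  have hX : 0 < bform G (k • α - m • p) (k • α - m • p) := by
    simp only [bform_sub_left, bform_sub_right, bform_smul_left, bform_smul_right,
      bform_comm hG α p]
    have : 0 < m ^ 2 * bform G p p := mul_pos (sq_pos_of_neg hm) hpp
    have b1 : 0 ≤ k * (k * bform G α α - bform G p α * m) :=
      mul_nonneg hk.le (by linarith)
    have b2 : 0 < k * (bform G p α * -m) := by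
      apply mul_pos hk (mul_pos hpα (by linarith))
    nlinarith
  have hneg := hL _ (γ - β) hX (by
    simp only [bform_sub_left, bform_sub_right, bform_smul_left, ← hmdef, ← hkdef]
    linarith) (sub_ne_zero.2 hne)
  simp only [bform_sub_left, bform_sub_right, bform_comm hG β γ] at hneg
  have hcpos : 0 < c := by
    by_contra h
    push Not at h
    nlinarith
  have hc1 : c ≠ 1 := by
    intro h
    rw [h] at hpδ
    linarith
  obtain ⟨hγ4, hβγ⟩ : bform G γ γ = -4 ∧ bform G γ β = -2 ∧ c = 2 := by
    rcases hβ.norm_eq with e | e <;> rcases hγ.norm_eq with e' | e' <;> rw [e] at hc hneg <;>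
      rw [e'] at hneg <;> omega
  have hr2 := hβ.sub_cpair hG hγ
  have hc2 : cpair G β γ = 1 := by
    have := hγ.cpair_mul hG β
    rw [hγ4, bform_comm hG, hβγ.1] at this
    omega
  rw [hc2, one_smul] at hr2
  have hε : 0 < bform G p (γ - β) := by
    have := hp _ hr2
    rw [bform_sub_right] at this ⊢
    omega
  have hεr : IsRoot G (γ - β) := by
    have := hr2.neg
    rwa [neg_sub] at this
  have t := tie _ hεr hε (by rw [bform_sub_right, bform_sub_right]; linarith)
  rw [bform_sub_right] at t
  rw [hpδ, hβγ.2] at hpδ'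
  linarith

lemma reflection_mem_closure (hG : G.IsSymm) (hL : IsLorentzian G) (hpp : 0 < bform G p p)
    (hp : IsGeneric G p) (k : ℕ) : ∀ {α : Fin n → ℤ}, IsRoot G α → 0 < bform G p α →
      (bform G p α).toNat = k → ∀ {f : (Fin n → ℤ) ≃ₗ[ℤ] (Fin n → ℤ)}, IsReflectionIn G f α →
      f ∈ Subgroup.closure (simpleReflections G p) := by
  induction k using Nat.strong_induction_on with
  | _ k ih =>
    intro α hα hpα hk f hf
    obtain ⟨β, hβ, hαβ⟩ := exists_isSimpleRoot hG hL hpp hp hα hpα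
    by_cases h : α = β
    · exact Subgroup.subset_closure ⟨α, h ▸ hβ, hf⟩
    · obtain ⟨s, hs⟩ := hβ.isRoot.exists_reflection hG
      have hsm : s ∈ Subgroup.closure (simpleReflections G p) :=
        Subgroup.subset_closure ⟨β, hβ, hs⟩
      have hso := hs.mem_orthGroup hG hβ.isRoot
      have h1 := hβ.pos_of_ne α hα hpα h
      have hc := hβ.isRoot.cpair_mul hG α
      have hcpos : 0 < cpair G α β := by
        rcases hβ.isRoot.norm_eq with e | e <;> rw [e] at hc <;> omega
      have h2 : bform G p (α - cpair G α β • β) < bform G p α := by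
        rw [bform_sub_right, bform_smul_right]
        nlinarith [hβ.pos]
      have hconj := hf.conj hso
      rw [hs α] at hconj
      have h3 := ih _ (by omega) (hα.sub_cpair hG hβ.isRoot) h1 rfl hconj
      have e : f = s⁻¹ * (s * f * s⁻¹) * s := by group
      rw [e]
      exact mul_mem (mul_mem (inv_mem hsm) h3) hsm

/-- A product of reflections mapping positive roots to positive roots is trivial. -/
theorem eq_one_of_mem_closure_of_pos (hG : G.IsSymm) (hL : IsLorentzian G)
    (hpp : 0 < bform G p p) (hp : IsGeneric G p) {f : (Fin n → ℤ) ≃ₗ[ℤ] (Fin n → ℤ)}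
    (hf : f ∈ Subgroup.closure {f | IsReflection G f})
    (hpos : ∀ α, IsRoot G α → 0 < bform G p α → 0 < bform G p (f α)) : f = 1 := by
  have hle : Subgroup.closure {f | IsReflection G f} ≤
      Subgroup.closure (simpleReflections G p) := by
    rw [Subgroup.closure_le]
    rintro f ⟨α, hα, hf⟩
    rcases lt_or_gt_of_ne (hp α hα) with h | h
    · have hf' : IsReflectionIn G f α := hf
      exact reflection_mem_closure hG hL hpp hp _ hα.neg (by rw [bform_neg_right]; linarith) rfl
        (hf'.neg hG hα)
    · exact reflection_mem_closure hG hL hpp hp _ hα h rfl hf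
  have hf' := hle hf
  rw [← Subgroup.mem_toSubmonoid, Subgroup.closure_toSubmonoid] at hf'
  obtain ⟨L, hL', rfl⟩ := Submonoid.exists_list_of_mem_closure hf'
  refine list_prod_eq_one hG hp _ L rfl (fun f hf => ?_) hpos
  rcases hL' f hf with h | h
  · exact h
  · obtain ⟨α, hα, hr⟩ := h
    rw [← inv_inv f, hr.inv_eq hα.isRoot]
    exact ⟨α, hα, hr⟩

end Generation

section Parabolic

variable {n : ℕ} {G : Matrix (Fin n) (Fin n) ℤ}

/-- The Eichler transvection attached to an isotropic vector `e` and a vector `w ⊥ e`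
with `(w, w) = 2r`. -/
lemma exists_transvection (hG : G.IsSymm) {e w : Fin n → ℤ} {r : ℤ} (he : bform G e e = 0)
    (hew : bform G e w = 0) (hw : bform G w w = 2 * r) :
    ∃ g ∈ OrthGroup n G, ∀ x,
      g x = x + bform G e x • w - (bform G w x + r * bform G e x) • e := by
  have hwe : bform G w e = 0 := by rw [bform_comm hG, hew]
  let T (w : Fin n → ℤ) : (Fin n → ℤ) →ₗ[ℤ] (Fin n → ℤ) :=
    { toFun := fun x => x + bform G e x • w - (bform G w x + r * bform G e x) • e
      map_add' := fun x y => by simp only [bform_add_right]; module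
      map_smul' := fun c x => by simp only [bform_smul_right, RingHom.id_apply]; module }
  have hT (w x) : T w x = x + bform G e x • w - (bform G w x + r * bform G e x) • e := rfl
  have inv (w : Fin n → ℤ) (hew : bform G e w = 0) (hwe : bform G w e = 0)
      (hw : bform G w w = 2 * r) (x : Fin n → ℤ) : T (-w) (T w x) = x := by
    rw [hT (-w), hT w]
    simp only [bform_add_right, bform_sub_right, bform_smul_right, bform_neg_left, he, hew, hwe,
      hw]
    module
  refine ⟨LinearEquiv.ofLinearMap (T w) (T (-w)) (LinearMap.ext fun x => ?_)
    (LinearMap.ext fun x => inv w hew hwe hw x), fun x y => ?_, fun x => rfl⟩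
  · have := inv (-w) (by rw [bform_neg_right, hew, neg_zero])
      (by rw [bform_neg_left, hwe, neg_zero])
      (by rw [bform_neg_left, bform_neg_right, neg_neg, hw]) x
    rwa [neg_neg] at this
  · change bform G (T w x) (T w y) = _
    rw [hT, hT]
    simp only [bform_add_right, bform_sub_right, bform_smul_right, bform_add_left,
      bform_sub_left, bform_smul_left, he, hew, hwe, hw, bform_comm hG x e, bform_comm hG x w]
    ring

lemma IsLorentzian.nonpos_of_isotropic (hG : G.IsSymm) (hL : IsLorentzian G) {e y : Fin n → ℤ}
    (he : bform G e e = 0) (he0 : e ≠ 0) (hey : bform G e y = 0) : bform G y y ≤ 0 := by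
  by_contra h
  push Not at h
  have := hL y e h (by rw [bform_comm hG, hey]) he0
  omega

/-- If `p` is close enough to the cusp `e`, then the mirrors not passing through `e` do not
separate `p` from `e`. -/
lemma IsRoot.pos_of_pos_cusp (hG : G.IsSymm) (hL : IsLorentzian G) {e p α : Fin n → ℤ}
    (he : bform G e e = 0) (hep : 0 < bform G e p) (hpp : 4 * bform G e p ^ 2 < bform G p p)
    (hα : IsRoot G α) (h : 0 < bform G e α) : 0 < bform G p α := by
  by_contra hcon
  push Not at hcon
  have he0 : e ≠ 0 := by
    rintro rfl
    simp [bform] at hep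
  have key := hL.nonpos_of_isotropic hG (y := bform G e p • α - bform G e α • p) he he0 (by
    simp only [bform_sub_right, bform_smul_right]; ring)
  simp only [bform_sub_right, bform_smul_right, bform_sub_left, bform_smul_left,
    bform_comm hG α p] at key
  set b := bform G e p
  set m := bform G e α
  set P := bform G p p
  set k := bform G p α
  have h1 : -4 * b ^ 2 ≤ b ^ 2 * bform G α α := by
    rcases hα.norm_eq with h | h <;> rw [h] <;> nlinarith [sq_nonneg b]
  have h2 : 0 ≤ b * m * -k := mul_nonneg (mul_pos hep h).le (by linarith)
  have hP : 0 < P := by nlinarith [sq_nonneg b]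
  have hm : 1 ≤ m ^ 2 := by nlinarith
  have h3 : P ≤ m ^ 2 * P := le_mul_of_one_le_left hP.le hm
  nlinarith

/-- A Lorentzian lattice is not reflective if, for some isotropic vector `e`, a vector `w ⊥ e`
of nonzero square is orthogonal to all roots orthogonal to `e`. -/
theorem not_finiteIndex_Wr (hG : G.IsSymm) (hL : IsLorentzian G) {e w p : Fin n → ℤ} {r : ℤ}
    (he : bform G e e = 0) (hew : bform G e w = 0) (hw : bform G w w = 2 * r) (hr : r ≠ 0)
    (hep : 0 < bform G e p) (hpp : 4 * bform G e p ^ 2 < bform G p p)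
    (hwα : ∀ α, IsRoot G α → bform G e α = 0 → bform G w α = 0)
    (hpα : ∀ α, IsRoot G α → bform G e α = 0 → bform G p α ≠ 0) :
    ¬ (Wr n G).FiniteIndex := by
  intro hfin
  have hwe : bform G w e = 0 := by rw [bform_comm hG, hew]
  have he0 : e ≠ 0 := by
    rintro rfl
    simp [bform] at hep
  have hgen : IsGeneric G p := fun α hα => by
    rcases lt_trichotomy (bform G e α) 0 with h | h | h
    · have := hα.neg.pos_of_pos_cusp hG hL he hep hpp (by rw [bform_neg_right]; linarith)
      rw [bform_neg_right] at this
      omega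
    · exact hpα α hα h
    · exact (hα.pos_of_pos_cusp hG hL he hep hpp h).ne'
  obtain ⟨g, hg, hgx⟩ := exists_transvection hG he hew hw
  have hge : g e = e := by
    rw [hgx, he, hwe]
    module
  have hgpos : ∀ α, IsRoot G α → 0 < bform G p α → 0 < bform G p (g α) := fun α hα hpos => by
    have hge' : bform G e (g α) = bform G e α := by rw [← hg e α, hge]
    rcases lt_trichotomy (bform G e α) 0 with h | h | h
    · have := hα.neg.pos_of_pos_cusp hG hL he hep hpp (by rw [bform_neg_right]; linarith)
      rw [bform_neg_right] at this
      omega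
    · have : g α = α := by
        rw [hgx, h, hwα α hα h]
        module
      rwa [this]
    · exact (hα.map hg).pos_of_pos_cusp hG hL he hep hpp (by rwa [hge'])
  obtain ⟨k, hk, hkW⟩ := Subgroup.exists_pow_mem_of_index_ne_zero hfin.index_ne_zero
    (⟨g, hg⟩ : OrthGroup n G)
  have hmem : g ^ k ∈ Subgroup.closure {f | IsReflection G f} := by
    have h1 : g ^ k ∈ (Wr n G).map (OrthGroup n G).subtype := ⟨_, hkW.2, rfl⟩
    rw [Wr, MonoidHom.map_closure] at h1
    refine Subgroup.closure_mono ?_ h1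
    rintro _ ⟨f, hf, rfl⟩
    exact hf
  have hpow : ∀ j : ℕ, ∀ α, IsRoot G α → 0 < bform G p α →
      IsRoot G ((g ^ j) α) ∧ 0 < bform G p ((g ^ j) α) := by
    intro j α hα hpos
    induction j with
    | zero => exact ⟨hα, hpos⟩
    | succ j ih =>
      rw [pow_succ']
      exact ⟨ih.1.map hg, hgpos _ ih.1 ih.2⟩
  have hb : 0 < bform G p p := by nlinarith [sq_nonneg (bform G e p)]
  have h1 := eq_one_of_mem_closure_of_pos hG hL hb hgen hmem fun α hα hpos => (hpow k α hα hpos).2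
  have h2 : ∀ j : ℕ, (g ^ j) w = w - (j * (2 * r)) • e := by
    intro j
    induction j with
    | zero => simp
    | succ j ih =>
      rw [pow_succ']
      change g ((g ^ j) w) = _
      rw [ih, map_sub, map_smul, hge, hgx w, hew, hw]
      push_cast
      module
  have h3 := h2 k
  rw [h1] at h3
  have h4 : ((k : ℤ) * (2 * r)) • e = 0 := by
    have h5 : w = w - ((k : ℤ) * (2 * r)) • e := h3
    exact sub_eq_self.1 h5.symm
  rcases smul_eq_zero.1 h4 with h | h
  · have : (k : ℤ) ≠ 0 := by exact_mod_cast (by omega : k ≠ 0)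
    simp_all
  · exact he0 h

end Parabolic

section CoxeterCusp

/-- First isotropic coordinate of an isometric embedding of `S ⊗ ℚ` into the orthogonal sum of a
hyperbolic plane and a diagonal negative definite space. -/
def hypRow₁ : Fin 18 → ℤ :=
  ![17, 31, 25, -17, -1, -3, -5, 6, 4, -3, -3, 4, 0, 0, -1, 1, -16, 18]

/-- Second isotropic coordinate of the embedding. -/
def hypRow₂ : Fin 18 → ℤ :=
  ![29, 54, 43, -29, -2, -6, -8, 11, 7, -6, -6, 8, 0, 0, -2, 2, -28, 30]

/-- Coordinates of the embedding in the diagonal negative definite space. -/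
def diagRow : Matrix (Fin 17) (Fin 18) ℤ :=
  !![14, 25, 20, -14, -1, -3, -3, 5, 3, -2, -2, 4, 0, 0, -2, 2, -13, 15;
     -30, -55, -44, 30, 3, 5, 9, -11, -9, 6, 6, -8, 0, 0, 2, -2, 27, -33;
     30, 53, 44, -26, -1, -7, -11, 13, 7, -6, -6, 8, 0, 0, -2, 2, -29, 31;
     -62, -115, -92, 62, 3, 13, 17, -23, -13, 14, 10, -16, 0, 0, 6, -6, 59, -65;
     -34, -59, -48, 34, 3, 5, 9, -11, -9, 6, 6, -8, 0, 0, 2, -2, 35, -33;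
     -62, -115, -92, 62, 3, 13, 17, -23, -13, 10, 14, -16, 0, 0, 2, -2, 59, -65;
     30, 57, 44, -34, -1, -3, -11, 13, 7, -6, -6, 8, 0, 0, -2, 2, -29, 31;
     14, 25, 20, -14, -1, -3, -3, 5, 3, -2, -2, 4, 0, 0, -2, -2, -13, 15;
     38, 73, 60, -38, -5, -7, -11, 13, 11, -6, -6, 8, 0, 0, -2, 2, -37, 39;
     14, 25, 20, -14, -1, -3, -3, 5, 3, -2, -6, 0, 4, 0, -2, 2, -13, 15;
     22, 41, 32, -22, -1, -3, -7, 5, 7, -6, -6, 8, 0, 0, -2, 2, -21, 23;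
     14, 25, 20, -14, -1, -3, -3, 5, 3, -2, -2, 4, -4, 4, -2, 2, -13, 15;
     14, 25, 20, -14, -1, -3, -3, 5, 3, -2, -2, 4, 0, -4, 2, 2, -13, 15;
     14, 25, 20, -14, -1, -3, -3, 5, 3, -6, -2, 4, 0, 0, 2, -2, -13, 15;
     0, -1, 0, 0, 0, 0, 0, 0, 0, 0, 0, 0, 0, 0, 0, 0, 1, -1;
     1, 2, 1, -1, 1, -1, 0, 0, 1, 0, 0, 0, 0, 0, 0, 0, -1, 1;
     -1, -2, -1, 1, 0, 0, 1, -1, 0, 0, 0, 0, 0, 0, 0, 0, 1, -1]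

/-- Weights of the diagonal negative definite form (up to the factor `-1/16`). -/
def diagWeight : Fin 17 → ℤ := ![2, 2, 1, 1, 1, 1, 1, 1, 1, 1, 1, 1, 1, 1, 16, 16, 16]

/-- Twice the inverse of the Gram matrix of `E₇`. -/
def gramE7DoubleInv : Matrix (Fin 7) (Fin 7) ℤ :=
  !![-4, -4, -6, -8, -6, -4, -2;
     -4, -7, -8, -12, -9, -6, -3;
     -6, -8, -12, -16, -12, -8, -4;
     -8, -12, -16, -24, -18, -12, -6;
     -6, -9, -12, -18, -15, -10, -5;
     -4, -6, -8, -12, -10, -8, -4;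
     -2, -3, -4, -6, -5, -4, -3]

/-- Twice the inverse of `gramS`. -/
def gramSDoubleInv : Matrix (Fin 18) (Fin 18) ℤ :=
  dsum (2 • gramU) (dsum gramE7DoubleInv (dsum gramE7DoubleInv (dsum !![-1] !![-1])))

/-- `gramS`, indexed by `Fin 18`. -/
def gramS18 : Matrix (Fin 18) (Fin 18) ℤ := gramS

lemma gramS18_isSymm : gramS18.IsSymm :=
  Matrix.IsSymm.ext fun i j => sub_eq_zero.1 <| by
    revert i j
    decide +kernel

lemma gramSDoubleInv_mul : gramSDoubleInv * gramS18 = (2 : ℤ) • 1 :=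
  Matrix.ext (by decide +kernel)

lemma sixteen_mul_gramS18 (i j : Fin 18) :
    16 * gramS18 i j = 16 * (hypRow₁ i * hypRow₂ j + hypRow₂ i * hypRow₁ j) -
      ∑ k, diagWeight k * (diagRow k i * diagRow k j) := by
  revert i j
  decide +kernel

lemma sixteen_mul_bform (x y : Fin 18 → ℤ) :
    16 * bform gramS18 x y =
      16 * ((hypRow₁ ⬝ᵥ x) * (hypRow₂ ⬝ᵥ y) + (hypRow₂ ⬝ᵥ x) * (hypRow₁ ⬝ᵥ y)) -
        ∑ k, diagWeight k * ((diagRow k ⬝ᵥ x) * (diagRow k ⬝ᵥ y)) := by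
  have h : 16 * bform gramS18 x y = ∑ i, ∑ j, x i * y j * (16 * gramS18 i j) := by
    simp only [bform, dotProduct, mulVec, Finset.mul_sum]
    exact Finset.sum_congr rfl fun i _ => Finset.sum_congr rfl fun j _ => by ring
  have h2 (r s : Fin 18 → ℤ) : ∑ i, ∑ j, x i * y j * (r i * s j) = (r ⬝ᵥ x) * (s ⬝ᵥ y) := by
    simp only [dotProduct, Finset.sum_mul_sum]
    exact Finset.sum_congr rfl fun i _ => Finset.sum_congr rfl fun j _ => by ring
  simp only [h, sixteen_mul_gramS18, mul_sub, Finset.sum_sub_distrib, mul_left_comm _ (16 : ℤ),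
    mul_add, Finset.sum_add_distrib, ← Finset.mul_sum, h2]
  congr 1
  simp only [Finset.mul_sum]
  rw [Finset.sum_congr rfl fun i _ => Finset.sum_comm, Finset.sum_comm]
  refine Finset.sum_congr rfl fun k _ => ?_
  simp only [mul_left_comm _ (diagWeight k), ← Finset.mul_sum, h2]

/-- The vector representing the linear form `φ`, if there is one. -/
def dualVector (φ : Fin 18 → ℤ) : Fin 18 → ℤ := fun i => (φ ᵥ* gramSDoubleInv) i / 2

lemma bform_dualVector {φ : Fin 18 → ℤ} (h : ∀ i, 2 ∣ (φ ᵥ* gramSDoubleInv) i)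
    (x : Fin 18 → ℤ) : bform gramS18 (dualVector φ) x = φ ⬝ᵥ x := by
  have h1 : (2 : ℤ) • dualVector φ = φ ᵥ* gramSDoubleInv :=
    funext fun i => Int.mul_ediv_cancel' (h i)
  have h2 : (2 : ℤ) * bform gramS18 (dualVector φ) x = 2 * (φ ⬝ᵥ x) := by
    rw [← bform_smul_left, h1, bform, dotProduct_mulVec, vecMul_vecMul, gramSDoubleInv_mul,
      vecMul_smul, vecMul_one, smul_dotProduct, smul_eq_mul]
  exact mul_left_cancel₀ two_ne_zero h2

lemma eq_zero_of_rows {x : Fin 18 → ℤ} (h₁ : hypRow₁ ⬝ᵥ x = 0) (h₂ : hypRow₂ ⬝ᵥ x = 0)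
    (h : ∀ k, diagRow k ⬝ᵥ x = 0) : x = 0 := by
  have h3 : gramS18 *ᵥ x = 0 := funext fun i => by
    have := sixteen_mul_bform (Pi.single i 1) x
    simp only [h₁, h₂, h, mul_zero, add_zero, Finset.sum_const_zero, sub_zero] at this
    rw [bform, single_one_dotProduct] at this
    exact (mul_eq_zero.1 this).resolve_left (by norm_num)
  have h4 : (2 : ℤ) • x = 0 := by
    rw [← one_mulVec x, ← smul_mulVec, ← gramSDoubleInv_mul, ← mulVec_mulVec, h3, mulVec_zero]
  exact (smul_eq_zero.1 h4).resolve_left two_ne_zero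

lemma isLorentzian_gramS18 : IsLorentzian gramS18 := by
  intro x y hx hxy hy
  by_contra hyy
  push Not at hyy
  have hxx := sixteen_mul_bform x x
  have hxy' := sixteen_mul_bform x y
  have hyy' := sixteen_mul_bform y y
  have hw : ∀ k, 0 < diagWeight k := by decide
  have hnn (z : Fin 18 → ℤ) (k) : 0 ≤ diagWeight k * ((diagRow k ⬝ᵥ z) * (diagRow k ⬝ᵥ z)) :=
    mul_nonneg (hw k).le (mul_self_nonneg _)
  have cs := Finset.sum_sq_le_sum_mul_sum_of_sq_le_mul Finset.univ (fun k _ => hnn x k)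
    (fun k _ => hnn y k) (r := fun k => diagWeight k * ((diagRow k ⬝ᵥ x) * (diagRow k ⬝ᵥ y)))
    fun k _ => (by ring : _ = _).le
  have hNx := Finset.sum_nonneg fun k (_ : k ∈ Finset.univ) => hnn x k
  have hNy := Finset.sum_nonneg fun k (_ : k ∈ Finset.univ) => hnn y k
  have hy0 := fun h => (Finset.sum_eq_zero_iff_of_nonneg fun k (_ : k ∈ Finset.univ) => hnn y k).1 h
  rw [hxy] at hxy'
  set u := hypRow₁ ⬝ᵥ x
  set v := hypRow₂ ⬝ᵥ x
  generalize hu' : hypRow₁ ⬝ᵥ y = u' at *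
  generalize hv' : hypRow₂ ⬝ᵥ y = v' at *
  generalize ∑ k, diagWeight k * ((diagRow k ⬝ᵥ x) * (diagRow k ⬝ᵥ x)) = X at *
  generalize ∑ k, diagWeight k * ((diagRow k ⬝ᵥ x) * (diagRow k ⬝ᵥ y)) = R at *
  generalize ∑ k, diagWeight k * ((diagRow k ⬝ᵥ y) * (diagRow k ⬝ᵥ y)) = Y at *
  have huv : X < 32 * (u * v) := by linarith
  have huv' : Y ≤ 32 * (u' * v') := by linarith
  have hR : R = 16 * (u * v' + v * u') := by linarith
  rw [hR] at cs
  have h4 : 4 * (u * v) * (u' * v') ≤ (u * v' + v * u') ^ 2 := by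
    nlinarith [sq_nonneg (u * v' - v * u')]
  have h5 : X * Y ≤ X * (32 * (u' * v')) := mul_le_mul_of_nonneg_left huv' hNx
  have h6 : 0 ≤ u' * v' := by linarith
  have h7 : u' * v' = 0 := by
    by_contra hne
    have : 0 < u' * v' := lt_of_le_of_ne h6 (Ne.symm hne)
    nlinarith
  have hY : Y = 0 := by linarith
  have huv0 : 0 < u * v := by linarith
  have hs : u * v' + v * u' = 0 := by
    have : (16 * (u * v' + v * u')) ^ 2 ≤ 0 := by rw [hY, mul_zero] at cs; exact cs
    have := pow_eq_zero_iff (two_ne_zero) |>.1 (le_antisymm this (sq_nonneg _))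
    omega
  have hu0 : u ≠ 0 := by rintro h; simp [h] at huv0
  have hv0 : v ≠ 0 := by rintro h; simp [h] at huv0
  have huv0' : u' = 0 ∧ v' = 0 := by
    rcases mul_eq_zero.1 h7 with h | h <;> simp_all
  refine hy (eq_zero_of_rows (hu'.trans huv0'.1) (hv'.trans huv0'.2) fun k => ?_)
  have := hy0 hY k (Finset.mem_univ k)
  simpa [(hw k).ne'] using this

lemma add_mul_sum_le_sum_sq (c : Fin 12 → ℤ) (r t : ℤ) (h : ∀ i, r + t * c i ≤ c i ^ 2) :
    12 * r + t * ∑ i, c i ≤ ∑ i, c i ^ 2 := by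
  have := Finset.sum_le_sum fun i (_ : i ∈ Finset.univ) => h i
  simpa [Finset.sum_add_distrib, ← Finset.mul_sum] using this

lemma Int.mul_add_one_nonneg (k : ℤ) : 0 ≤ k * (k + 1) := by
  rcases lt_or_ge k 0 with h | h
  · exact mul_nonneg_of_nonpos_of_nonpos h.le (by omega)
  · positivity

/-- The arithmetic of the roots orthogonal to the cusp, when the coordinates are divisible
by `4`. -/
lemma add_eq_zero_of_norm_le {a b P : ℤ} {c : Fin 12 → ℤ} (hP : 0 ≤ P)
    (hsum : 2 * a + 2 * b + ∑ i, c i = 0)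
    (hN : 2 * a ^ 2 + 2 * b ^ 2 + ∑ i, c i ^ 2 + P = 2 ∨
      2 * a ^ 2 + 2 * b ^ 2 + ∑ i, c i ^ 2 + P = 4 ∧ ∀ i, 2 ∣ c i - c 0) : a + b = 0 := by
  have key {x y m F : ℤ} (hs : x + y + m = 0 ∨ 2 * x + 2 * y + m = 0) (hm : m ^ 2 ≤ 12 * F)
      (hB : F ≠ 0 → x ^ 2 + y ^ 2 = 0) : x + y = 0 := by
    by_cases hF : F = 0
    · have : m = 0 := by
        rw [hF, mul_zero] at hm
        exact pow_eq_zero_iff two_ne_zero |>.1 (le_antisymm hm (sq_nonneg m))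
      omega
    · have hx : x = 0 := by nlinarith [hB hF, sq_nonneg x, sq_nonneg y]
      have hy : y = 0 := by nlinarith [hB hF, sq_nonneg x, sq_nonneg y]
      omega
  have hcs (d : Fin 12 → ℤ) : (∑ i, d i) ^ 2 ≤ 12 * ∑ i, d i ^ 2 := by
    simpa using sq_sum_le_card_mul_sum_sq (s := Finset.univ) (f := d)
  have hQ : 0 ≤ ∑ i, c i ^ 2 := Finset.sum_nonneg fun i _ => sq_nonneg _
  rcases hN with hN | ⟨hN, h2⟩
  · refine key (Or.inr hsum) (hcs c) fun h => ?_
    have := sq_nonneg a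
    have := sq_nonneg b
    omega
  · rcases Int.even_or_odd' (c 0) with ⟨m, hm | hm⟩
    · have hd (i) : ∃ d, c i = 2 * d := by
        obtain ⟨s, hs⟩ := h2 i
        exact ⟨s + m, by omega⟩
      choose d hd using hd
      simp only [hd, mul_pow, ← Finset.mul_sum] at hN hsum hQ
      refine key (Or.inl (by omega)) (hcs d) fun h => ?_
      have := sq_nonneg a
      have := sq_nonneg b
      omega
    · have := add_mul_sum_le_sum_sq c 1 0 fun i => by
        obtain ⟨s, hs⟩ := h2 i
        rw [show c i = 2 * (s + m) + 1 by omega]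
        nlinarith [Int.mul_add_one_nonneg (s + m)]
      nlinarith [sq_nonneg a, sq_nonneg b]

/-- The arithmetic of the roots orthogonal to the cusp. -/
lemma add_eq_zero_of_norm {a b p q r : ℤ} {c : Fin 12 → ℤ}
    (hsum : 2 * a + 2 * b + ∑ i, c i = 0) (ha : 4 ∣ a - c 0) (hb : 4 ∣ b - c 0)
    (hc : ∀ i, 4 ∣ c i - c 0) (hpar : 2 ∣ a + p + q + r)
    (hN : 2 * a ^ 2 + 2 * b ^ 2 + ∑ i, c i ^ 2 + 16 * (p ^ 2 + q ^ 2 + r ^ 2) = 32 ∨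
      2 * a ^ 2 + 2 * b ^ 2 + ∑ i, c i ^ 2 + 16 * (p ^ 2 + q ^ 2 + r ^ 2) = 64 ∧
        (∀ i, 8 ∣ c i - c 0) ∧ 2 ∣ p + q ∧ 2 ∣ q + r) : a + b = 0 := by
  have hP : 0 ≤ p ^ 2 + q ^ 2 + r ^ 2 := by positivity
  obtain ⟨s, hs⟩ := ha
  obtain ⟨t, ht⟩ := hb
  choose d hd using hc
  have hodd (hodd : c 0 % 2 = 1) (h : 48 ≤ 2 * a ^ 2 + 2 * b ^ 2 + ∑ i, c i ^ 2) : a + b = 0 := by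
    exfalso
    rcases hN with hN | ⟨hN, -, h1, h2⟩
    · omega
    · have hsq {x : ℤ} (hx : x % 2 = 1) : 1 ≤ x ^ 2 := by
        have : x ≠ 0 := by rintro rfl; simp at hx
        have := sq_pos_of_ne_zero this
        omega
      have := hsq (show p % 2 = 1 by omega)
      have := hsq (show q % 2 = 1 by omega)
      have := hsq (show r % 2 = 1 by omega)
      omega
  obtain ⟨m, hm⟩ : ∃ m, c 0 = 4 * m + c 0 % 4 := ⟨c 0 / 4, by omega⟩
  have h4 : c 0 % 4 = 0 ∨ c 0 % 4 = 1 ∨ c 0 % 4 = 2 ∨ c 0 % 4 = 3 := by omega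
  rcases h4 with h | h | h | h <;> rw [h] at hm
  · have hc' (i) : c i = 4 * (d i + m) := by linarith [hd i]
    have ha' : a = 4 * (s + m) := by linarith
    have hb' : b = 4 * (t + m) := by linarith
    rw [Finset.sum_congr rfl fun i _ => hc' i, ← Finset.mul_sum, ha', hb'] at hsum
    rw [Finset.sum_congr rfl fun i _ => congrArg (· ^ 2) (hc' i), ha', hb'] at hN
    simp only [mul_pow, ← Finset.mul_sum] at hN
    have := add_eq_zero_of_norm_le (a := s + m) (b := t + m) (c := fun i => d i + m) hP
      (by linarith) (hN.imp (fun h => by linarith) fun h => ⟨by linarith [h.1], fun i => by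
        have := h.2.1 i
        rw [hc', hc'] at this
        omega⟩)
    rw [ha', hb']
    linarith
  · refine hodd (by omega) ?_
    have := add_mul_sum_le_sum_sq c 3 (-2) fun i => by
      rw [show c i = 4 * (d i + m) + 1 by linarith [hd i]]
      nlinarith [Int.mul_add_one_nonneg (d i + m)]
    have ha : 3 - 2 * a ≤ a ^ 2 := by
      rw [show a = 4 * (s + m) + 1 by linarith]
      nlinarith [Int.mul_add_one_nonneg (s + m)]
    have hb : 3 - 2 * b ≤ b ^ 2 := by
      rw [show b = 4 * (t + m) + 1 by linarith]
      nlinarith [Int.mul_add_one_nonneg (t + m)]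
    linarith
  · exfalso
    have h4 := add_mul_sum_le_sum_sq c 4 0 fun i => by
      rw [show c i = 4 * (d i + m) + 2 by linarith [hd i]]
      nlinarith [Int.mul_add_one_nonneg (d i + m)]
    rcases hN with hN | ⟨hN, h8, -⟩
    · nlinarith [sq_nonneg a, sq_nonneg b]
    · choose f hf using h8
      rcases Int.even_or_odd' m with ⟨l, hl | hl⟩
      · have := add_mul_sum_le_sum_sq c 12 (-4) fun i => by
          rw [show c i = 8 * (f i + l) + 2 by linarith [hf i]]
          nlinarith [Int.mul_add_one_nonneg (f i + l)]
        nlinarith [sq_nonneg (a + 2), sq_nonneg (b + 2)]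
      · have := add_mul_sum_le_sum_sq c 12 4 fun i => by
          rw [show c i = 8 * (f i + l) + 6 by linarith [hf i]]
          nlinarith [Int.mul_add_one_nonneg (f i + l)]
        nlinarith [sq_nonneg (a - 2), sq_nonneg (b - 2)]
  · refine hodd (by omega) ?_
    have := add_mul_sum_le_sum_sq c 3 2 fun i => by
      rw [show c i = 4 * (d i + m) + 3 by linarith [hd i]]
      nlinarith [Int.mul_add_one_nonneg (d i + m)]
    have ha : 3 + 2 * a ≤ a ^ 2 := by
      rw [show a = 4 * (s + m) + 3 by linarith]
      nlinarith [Int.mul_add_one_nonneg (s + m)]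
    have hb : 3 + 2 * b ≤ b ^ 2 := by
      rw [show b = 4 * (t + m) + 3 by linarith]
      nlinarith [Int.mul_add_one_nonneg (t + m)]
    linarith

/-- Uniqueness of balanced digits. -/
lemma eq_zero_of_sum_mul_pow_eq_zero {N : ℤ} (n : ℕ) (d : ℕ → ℤ) (t : ℤ)
    (hd : ∀ i < n, |d i| < N) (h : ∑ i ∈ Finset.range n, d i * N ^ i + N ^ n * t = 0) :
    ∀ i < n, d i = 0 := by
  induction n generalizing d with
  | zero => simp
  | succ n ih =>
    rw [Finset.sum_range_succ'] at h
    have hN : 0 < N := (abs_nonneg _).trans_lt (hd 0 n.succ_pos)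
    have h' : d 0 + N * (∑ i ∈ Finset.range n, d (i + 1) * N ^ i + N ^ n * t) = 0 := by
      rw [← h, mul_add, Finset.mul_sum, pow_zero, mul_one, pow_succ]
      simp only [pow_succ]
      rw [Finset.sum_congr rfl fun i _ => show N * (d (i + 1) * N ^ i) = d (i + 1) * (N ^ i * N) by
        ring]
      ring
    have h0 : d 0 = 0 := Int.eq_zero_of_abs_lt_dvd
      ⟨-(∑ i ∈ Finset.range n, d (i + 1) * N ^ i + N ^ n * t), by linarith⟩ (hd 0 n.succ_pos)
    rw [h0, zero_add] at h'
    have := ih (fun i => d (i + 1)) (fun i hi => hd (i + 1) (by omega))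
      ((mul_eq_zero.1 h').resolve_left hN.ne')
    rintro (_ | i) hi
    · exact h0
    · exact this i (by omega)

lemma dvd_dotProduct {n : ℕ} {m : ℤ} {r : Fin n → ℤ} (h : ∀ j, m ∣ r j) (x : Fin n → ℤ) :
    m ∣ r ⬝ᵥ x :=
  Finset.dvd_sum fun j _ => (h j).mul_right _

/-- The indices of the twelve unit-weight diagonal coordinates. -/
def midIdx (i : Fin 12) : Fin 17 := ⟨i + 2, by omega⟩

lemma sum_fin_seventeen (f : Fin 17 → ℤ) :
    ∑ k, f k = f 0 + f 1 + ∑ i, f (midIdx i) + f 14 + f 15 + f 16 := by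
  simp [Fin.sum_univ_succ, midIdx]
  ring

section Root

variable {α : Fin 18 → ℤ}

lemma two_dvd_dotProduct (h : ∀ x, 2 ∣ bform gramS18 α x) {φ : Fin 18 → ℤ}
    (hφ : ∀ i, 2 ∣ (φ ᵥ* gramSDoubleInv) i) : 2 ∣ φ ⬝ᵥ α := by
  rw [← bform_dualVector hφ, bform_comm gramS18_isSymm]
  exact h _

lemma sum_weight_eq (h : hypRow₂ ⬝ᵥ α = 0) :
    2 * (diagRow 0 ⬝ᵥ α) ^ 2 + 2 * (diagRow 1 ⬝ᵥ α) ^ 2 + ∑ i, (diagRow (midIdx i) ⬝ᵥ α) ^ 2 +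
      16 * ((diagRow 14 ⬝ᵥ α) ^ 2 + (diagRow 15 ⬝ᵥ α) ^ 2 + (diagRow 16 ⬝ᵥ α) ^ 2) =
    -16 * bform gramS18 α α := by
  have h1 := sixteen_mul_bform α α
  rw [h, sum_fin_seventeen] at h1
  have h2 : ∀ i, diagWeight (midIdx i) = 1 := by decide
  simp only [h2, one_mul, show diagWeight 0 = 2 from rfl, show diagWeight 1 = 2 from rfl,
    show diagWeight 14 = 16 from rfl, show diagWeight 15 = 16 from rfl,
    show diagWeight 16 = 16 from rfl, ← sq] at h1
  linarith

/-- All roots through the cusp are orthogonal to a common vector. -/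
lemma IsRoot.diagRow_add_eq_zero (hα : IsRoot gramS18 α) (h : hypRow₂ ⬝ᵥ α = 0) :
    diagRow 0 ⬝ᵥ α + diagRow 1 ⬝ᵥ α = 0 := by
  have hN := sum_weight_eq h
  refine add_eq_zero_of_norm (p := diagRow 14 ⬝ᵥ α) (q := diagRow 15 ⬝ᵥ α)
    (r := diagRow 16 ⬝ᵥ α) (c := fun i => diagRow (midIdx i) ⬝ᵥ α) ?_ ?_ ?_ (fun i => ?_) ?_ ?_
  · have h1 : (![2, 2, 1, 1, 1, 1, 1, 1, 1, 1, 1, 1, 1, 1, 0, 0, 0] : Fin 17 → ℤ) ᵥ* diagRow = 0 :=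
      funext (by decide +kernel)
    have h2 := congrArg (· ⬝ᵥ α) h1
    simp only [← dotProduct_mulVec, zero_dotProduct] at h2
    rw [dotProduct, sum_fin_seventeen] at h2
    simpa [midIdx, Fin.sum_univ_succ, mulVec] using h2
  · rw [← sub_dotProduct]
    exact dvd_dotProduct (by decide +kernel) α
  · rw [← sub_dotProduct]
    exact dvd_dotProduct (by decide +kernel) α
  · rw [← sub_dotProduct]
    exact dvd_dotProduct (by revert i; decide +kernel) α
  · simp only [← add_dotProduct]
    exact dvd_dotProduct (by decide +kernel) α
  · rcases hα with hα | ⟨hα, heven⟩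
    · left
      rw [hN, hα]
      rfl
    · refine Or.inr ⟨by rw [hN, hα]; rfl, fun i => ?_, ?_, ?_⟩
      · have h1 : diagRow (midIdx i) - diagRow (midIdx 0) =
            (4 : ℤ) • fun j => (diagRow (midIdx i) j - diagRow (midIdx 0) j) / 4 :=
          funext (by revert i; decide +kernel)
        rw [← sub_dotProduct, h1, smul_dotProduct, smul_eq_mul]
        exact mul_dvd_mul_left 4 (two_dvd_dotProduct heven (by revert i; decide +kernel))
      · rw [← add_dotProduct]
        exact two_dvd_dotProduct heven (by decide +kernel)
      · rw [← add_dotProduct]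
        exact two_dvd_dotProduct heven (by decide +kernel)

/-- A linear form whose dual vector is a generic point close to the cusp. -/
def genericForm (j : Fin 18) : ℤ :=
  32 ^ 18 * hypRow₁ j + 32 ^ 20 * hypRow₂ j + ∑ k : Fin 17, 32 ^ (k.1 + 1) * diagRow k j

lemma IsRoot.genericForm_ne_zero (hα : IsRoot gramS18 α) (h : hypRow₂ ⬝ᵥ α = 0) :
    genericForm ⬝ᵥ α ≠ 0 := by
  intro h0
  have h1 := sixteen_mul_bform α α
  rw [h, mul_zero, zero_mul, add_zero, mul_zero, zero_sub] at h1
  have hw : ∀ k, 1 ≤ diagWeight k := by decide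
  have hnn (k) : 0 ≤ diagWeight k * ((diagRow k ⬝ᵥ α) * (diagRow k ⬝ᵥ α)) :=
    mul_nonneg (zero_le_one.trans (hw k)) (mul_self_nonneg _)
  have hlt (k) : |diagRow k ⬝ᵥ α| < 32 := by
    have h2 := Finset.single_le_sum (fun k _ => hnn k) (Finset.mem_univ k)
    have h3 := hw k
    refine abs_lt_of_sq_lt_sq ?_ (by norm_num)
    have h4 : -4 ≤ bform gramS18 α α := by
      rcases hα.norm_eq with h | h <;> omega
    have h5 := le_mul_of_one_le_left (mul_self_nonneg (diagRow k ⬝ᵥ α)) h3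
    rw [sq]
    linarith
  have hsum : ∑ i ∈ Finset.range 17, (fun i : ℕ => diagRow (Fin.ofNat 17 i) ⬝ᵥ α) i * 32 ^ i +
      32 ^ 17 * (hypRow₁ ⬝ᵥ α) = 0 := by
    rw [← Fin.sum_univ_eq_sum_range
      (fun i : ℕ => (fun i : ℕ => diagRow (Fin.ofNat 17 i) ⬝ᵥ α) i * 32 ^ i) 17]
    have h2 : genericForm = (32 ^ 18 : ℤ) • hypRow₁ + (32 ^ 20 : ℤ) • hypRow₂ +
        ∑ k : Fin 17, (32 ^ (k.1 + 1) : ℤ) • diagRow k := by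
      ext j
      simp [genericForm, Finset.sum_apply]
    rw [h2, add_dotProduct, add_dotProduct, smul_dotProduct, smul_dotProduct, h,
      sum_dotProduct] at h0
    have h3 : (32 : ℤ) * (∑ k : Fin 17, (diagRow k ⬝ᵥ α) * 32 ^ k.1 +
        32 ^ 17 * (hypRow₁ ⬝ᵥ α)) = 0 := by
      rw [← h0, mul_add, Finset.mul_sum]
      simp only [smul_dotProduct, smul_eq_mul]
      rw [Finset.sum_congr rfl fun (k : Fin 17) _ => show
        32 * ((diagRow k ⬝ᵥ α) * 32 ^ k.1) = 32 ^ (k.1 + 1) * (diagRow k ⬝ᵥ α) by ring]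
      ring
    simpa using h3
  have hz := eq_zero_of_sum_mul_pow_eq_zero 17 _ _ (fun i _ => hlt _) hsum
  have hz' (k : Fin 17) : diagRow k ⬝ᵥ α = 0 := by simpa using hz k k.2
  simp only [hz', mul_zero, Finset.sum_const_zero, neg_zero] at h1
  rcases hα with hα | ⟨hα, -⟩ <;> omega

end Root

lemma not_finiteIndex_gramS18 : ¬ (Wr 18 gramS18).FiniteIndex := by
  have he : ∀ i, 2 ∣ (hypRow₂ ᵥ* gramSDoubleInv) i := by decide +kernel
  have hw : ∀ i, 2 ∣ ((diagRow 0 + diagRow 1) ᵥ* gramSDoubleInv) i := by decide +kernel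
  have hp : ∀ i, 2 ∣ (genericForm ᵥ* gramSDoubleInv) i := by decide +kernel
  refine not_finiteIndex_Wr gramS18_isSymm isLorentzian_gramS18 (e := dualVector hypRow₂)
    (w := dualVector (diagRow 0 + diagRow 1)) (p := dualVector genericForm) (r := -6)
    ?_ ?_ ?_ (by norm_num) ?_ ?_ (fun α hα h => ?_) fun α hα h => ?_
  · rw [bform_dualVector he]; decide +kernel
  · rw [bform_dualVector he]; decide +kernel
  · rw [bform_dualVector hw]; decide +kernel
  · rw [bform_dualVector he]; decide +kernel
  · rw [bform_dualVector he, bform_dualVector hp]; decide +kernel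
  · rw [bform_dualVector he] at h
    rw [bform_dualVector hw, add_dotProduct]
    exact hα.diagRow_add_eq_zero h
  · rw [bform_dualVector he] at h
    rw [bform_dualVector hp]
    exact hα.genericForm_ne_zero h

end CoxeterCusp

/-- The lattice `U ⊕ E₇ ⊕ E₇ ⊕ A₁ ⊕ A₁` is not reflective: the subgroup `W_r` of `O(S)`
generated by the reflections in all roots has infinite index in `O(S)`. -/
theorem not_reflective_18_4_1 : ¬ (Wr _ gramS).FiniteIndex := by
  exact not_finiteIndex_gramS18
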